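/- arXiv:1610.02143 — 4 statements merged into one kernel-verified Lean document; each statement's English description precedes it below -/
import Mathlib

section
/- For every integer K ≥ 6 and every real number N ≥ 3, ((4N+3)/(4(N+1)))^{K−5} · (4/(K−5) + 1/(N+1)) ≤ 4/(K−5). -/
/-- Bernoulli's inequality gives `(1 - y)^m (1 + m y) ≤ (1 - y²)^m ≤ 1`. -/
theorem one_sub_pow_mul_one_add_mul_le_one (m : ℕ) {y : ℝ} (h0 : 0 ≤ y) (h1 : y ≤ 1) :
    (1 - y) ^ m * (1 + m * y) ≤ 1 :=
  calc (1 - y) ^ m * (1 + m * y)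
      ≤ (1 - y) ^ m * (1 + y) ^ m :=
        mul_le_mul_of_nonneg_left (one_add_mul_le_pow (by linarith) m)
          (pow_nonneg (by linarith) m)
    _ = ((1 - y) * (1 + y)) ^ m := (mul_pow _ _ _).symm
    _ ≤ 1 := pow_le_one₀ (mul_nonneg (by linarith) (by linarith)) (by nlinarith)

/-- For every integer `K ≥ 6` and real `N ≥ 3`,
`((4N+3)/(4(N+1)))^(K−5) · (4/(K−5) + 1/(N+1)) ≤ 4/(K−5)`. -/
theorem cK_preserved_by_growth (K : ℕ) (hK : 6 ≤ K) (N : ℝ) (hN : 3 ≤ N) :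
    ((4 * N + 3) / (4 * (N + 1)))^(K - 5) * (4 / ((K:ℝ) - 5) + 1 / (N + 1))
      ≤ 4 / ((K:ℝ) - 5) := by
  obtain ⟨m, rfl⟩ : ∃ m, K = m + 5 := ⟨K - 5, by omega⟩
  have hm : (0 : ℝ) < m := by exact_mod_cast (by omega : 0 < m)
  have hN' : 0 < N + 1 := by linarith
  have hcast : ((m + 5 : ℕ) : ℝ) - 5 = m := by push_cast; ring
  have hbase : (4 * N + 3) / (4 * (N + 1)) = 1 - 1 / (4 * (N + 1)) := by
    field_simp
    ring
  have hfactor : 4 / (m : ℝ) + 1 / (N + 1) = 4 / m * (1 + m * (1 / (4 * (N + 1)))) := by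
    field_simp
  have hy : 1 / (4 * (N + 1)) ≤ 1 := by
    rw [div_le_one (by positivity)]
    linarith
  rw [hcast, Nat.add_sub_cancel, hbase, hfactor, mul_left_comm]
  exact mul_le_of_le_one_right (by positivity)
    (one_sub_pow_mul_one_add_mul_le_one m (by positivity) hy)
end

section
/- Let κ > 0, d > 0, β ∈ (0, 1], ξ ≥ 0, and let K ≥ 6 be an integer. Let N ≥ 3 be a real number, and set c(K) := 4/(K−5), H(n) := d·n^{−β}, and Γ := (4N+3)/(4(N+1)). If a real number u satisfies u ≤ c(K)·H(N) + (ξ/e^{K/5})·(3κ/(4N))^{K/5}, then Γ^K · (u + H(N)/(N+1)) ≤ c(K)·H(N+1) + (ξ/e^{K/5})·(3κ/(4(N+1)))^{K/5}. -/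
/-- Five contraction factors `1 - 1/(4(N+1))` together beat the ratio `N/(N+1)`. -/
theorem contraction_pow_five_le {N : ℝ} (hN : 3 ≤ N) :
    ((4 * N + 3) / (4 * (N + 1))) ^ 5 ≤ N / (N + 1) := by
  have hM : 0 < N + 1 := by linarith
  obtain ⟨t, ht, rfl⟩ : ∃ t : ℝ, 0 ≤ t ∧ N = t + 3 := ⟨N - 3, by linarith, by ring⟩
  rw [div_pow, div_le_div_iff₀ (by positivity) hM, ← sub_nonneg]
  ring_nf
  positivity

/-- Bernoulli's inequality in the form `(1 - x)^j (1 + j x) ≤ 1`. -/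
theorem one_sub_pow_mul_one_add_mul_le_one_s11 {x : ℝ} (hx0 : 0 ≤ x) (hx1 : x ≤ 1) (j : ℕ) :
    (1 - x) ^ j * (1 + j * x) ≤ 1 := by
  have hx : 0 ≤ 1 - x := by linarith
  calc (1 - x) ^ j * (1 + j * x) ≤ (1 - x) ^ j * (1 + x) ^ j := by
        gcongr
        exact one_add_mul_le_pow (by linarith) j
    _ = (1 - x ^ 2) ^ j := by rw [← mul_pow]; ring
    _ ≤ 1 := pow_le_one₀ (by nlinarith) (by nlinarith)

/-- The contraction over `K` iterations, as a real power of `N/(N+1)`. -/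
theorem contraction_pow_le_rpow {N : ℝ} (hN : 3 ≤ N) (K : ℕ) :
    ((4 * N + 3) / (4 * (N + 1))) ^ K ≤ (N / (N + 1)) ^ ((K : ℝ) / 5) := by
  have hΓ : 0 ≤ (4 * N + 3) / (4 * (N + 1)) := div_nonneg (by linarith) (by linarith)
  calc ((4 * N + 3) / (4 * (N + 1))) ^ K
      = (((4 * N + 3) / (4 * (N + 1))) ^ 5) ^ ((K : ℝ) / 5) := by
        rw [← Real.rpow_natCast _ 5, ← Real.rpow_mul hΓ, ← Real.rpow_natCast _ K]
        congr 1
        push_cast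
        ring
    _ ≤ (N / (N + 1)) ^ ((K : ℝ) / 5) :=
        Real.rpow_le_rpow (by positivity) (contraction_pow_five_le hN) (by positivity)

/-- The contraction absorbs the increment `1/(N+1)` of the statistical error coefficient. -/
theorem contraction_pow_mul_coeff_le {N : ℝ} (hN : 3 ≤ N) {K : ℕ} (hK : 6 ≤ K) :
    ((4 * N + 3) / (4 * (N + 1))) ^ K * (4 / ((K : ℝ) - 5) + 1 / (N + 1))
      ≤ 4 / ((K : ℝ) - 5) * (N / (N + 1)) := by
  obtain ⟨j, rfl⟩ := Nat.exists_eq_add_of_le (show 5 ≤ K by omega)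
  have hj : (0 : ℝ) < j := by exact_mod_cast (show 0 < j by omega)
  have hN0 : 0 < N := by linarith
  have hM : 0 < N + 1 := by linarith
  have hΓ : (4 * N + 3) / (4 * (N + 1)) = 1 - 1 / (4 * (N + 1)) := by field_simp; ring
  have hx1 : 1 / (4 * (N + 1)) ≤ 1 := by rw [div_le_one (by positivity)]; linarith
  have hsub : ((5 + j : ℕ) : ℝ) - 5 = j := by push_cast; ring
  have hcoeff : 4 / (j : ℝ) + 1 / (N + 1) = 4 / j * (1 + j * (1 / (4 * (N + 1)))) := by
    field_simp
  have hbern := one_sub_pow_mul_one_add_mul_le_one_s11 (by positivity) hx1 j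
  rw [← hΓ] at hbern
  rw [hsub, hcoeff, pow_add]
  calc _ = 4 / (j : ℝ) * (((4 * N + 3) / (4 * (N + 1))) ^ 5 *
          (((4 * N + 3) / (4 * (N + 1))) ^ j * (1 + j * (1 / (4 * (N + 1)))))) := by ring
    _ ≤ 4 / (j : ℝ) * (N / (N + 1) * 1) := by
        gcongr
        exact contraction_pow_five_le hN
    _ = _ := by rw [mul_one]


/-- Inductive step of Lemma 1: with `c(K) := 4/(K−5)`,
`H(n) := d·n^(−β)` and `Γ := (4N+3)/(4(N+1))`, if
`u ≤ c(K)·H(N) + (ξ/e^(K/5))·(3κ/(4N))^(K/5)`, then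
`Γ^K·(u + H(N)/(N+1)) ≤ c(K)·H(N+1) + (ξ/e^(K/5))·(3κ/(4(N+1)))^(K/5)`. -/
theorem online_saga_inductive_step
    (κ d β ξ N u : ℝ) (K : ℕ)
    (hκ : 0 < κ) (hd : 0 < d) (hβ0 : 0 < β) (hβ1 : β ≤ 1) (hξ : 0 ≤ ξ)
    (hK : 6 ≤ K) (hN : 3 ≤ N)
    (hu : u ≤ (4 / ((K:ℝ) - 5)) * (d * N ^ (-β))
        + (ξ / Real.exp ((K:ℝ) / 5)) * (3 * κ / (4 * N)) ^ ((K:ℝ) / 5)) :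
    ((4 * N + 3) / (4 * (N + 1)))^K * (u + (d * N ^ (-β)) / (N + 1))
      ≤ (4 / ((K:ℝ) - 5)) * (d * (N + 1) ^ (-β))
        + (ξ / Real.exp ((K:ℝ) / 5)) * (3 * κ / (4 * (N + 1))) ^ ((K:ℝ) / 5) := by
  have hN0 : 0 < N := by linarith
  have hM : 0 < N + 1 := by linarith
  have hc : 0 < 4 / ((K : ℝ) - 5) := by
    have : (6 : ℝ) ≤ K := by exact_mod_cast hK
    exact div_pos (by norm_num) (by linarith)
  have hratio : N / (N + 1) * N ^ (-β) ≤ (N + 1) ^ (-β) := by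
    have h : N / (N + 1) ≤ (N / (N + 1)) ^ β :=
      Real.self_le_rpow_of_le_one (by positivity)
        ((div_le_one hM).2 (by linarith)) hβ1
    calc N / (N + 1) * N ^ (-β) ≤ (N / (N + 1)) ^ β * N ^ (-β) := by gcongr
      _ = (N + 1) ^ (-β) := by
        rw [Real.div_rpow hN0.le hM.le, Real.rpow_neg hN0.le, Real.rpow_neg hM.le]
        field_simp
  have hstat : ((4 * N + 3) / (4 * (N + 1))) ^ K * (4 / ((K : ℝ) - 5) + 1 / (N + 1))
      * (d * N ^ (-β)) ≤ 4 / ((K : ℝ) - 5) * (d * (N + 1) ^ (-β)) :=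
    calc _ ≤ 4 / ((K : ℝ) - 5) * (N / (N + 1)) * (d * N ^ (-β)) := by
          gcongr ?_ * _
          exact contraction_pow_mul_coeff_le hN hK
      _ = 4 / ((K : ℝ) - 5) * (d * (N / (N + 1) * N ^ (-β))) := by ring
      _ ≤ _ := by gcongr
  have hopt : ((4 * N + 3) / (4 * (N + 1))) ^ K * (3 * κ / (4 * N)) ^ ((K : ℝ) / 5)
      ≤ (3 * κ / (4 * (N + 1))) ^ ((K : ℝ) / 5) :=
    calc _ ≤ (N / (N + 1)) ^ ((K : ℝ) / 5) * (3 * κ / (4 * N)) ^ ((K : ℝ) / 5) := by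
          gcongr
          exact contraction_pow_le_rpow hN K
      _ = _ := by
          rw [← Real.mul_rpow (by positivity) (by positivity)]
          congr 1
          field_simp
  calc _ ≤ ((4 * N + 3) / (4 * (N + 1))) ^ K * ((4 / ((K : ℝ) - 5)) * (d * N ^ (-β))
        + (ξ / Real.exp ((K : ℝ) / 5)) * (3 * κ / (4 * N)) ^ ((K : ℝ) / 5)
        + (d * N ^ (-β)) / (N + 1)) := by gcongr
    _ = ((4 * N + 3) / (4 * (N + 1))) ^ K * (4 / ((K : ℝ) - 5) + 1 / (N + 1))
          * (d * N ^ (-β)) + (ξ / Real.exp ((K : ℝ) / 5)) *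
          (((4 * N + 3) / (4 * (N + 1))) ^ K * (3 * κ / (4 * N)) ^ ((K : ℝ) / 5)) := by ring
    _ ≤ _ := by gcongr
end

section
/- Fix reals κ > 0, d > 0, β ∈ (0, 1], ξ ≥ 0, and assume N₀ := 3κ/4 is a natural number with N₀ ≥ 3. Define H(n) := d·n^{−β} and Γ_n := 1 − min(1/(4n), 1/(3κ)). Define the bound sequence U(k, n), for natural numbers n ≥ N₀ and k ≥ 0, recursively by U(0, N₀) = ξ and U(k, n) = min( Γ_n·U(k−1, n), min_{N₀ ≤ m < n} [ U(k, m) + ((n−m)/n)·H(m) ] ), where a term is omitted from the outer minimum when it is undefined (the first term when k = 0, the inner minimum when n = N₀). Then for every integer K ≥ 6 and every natural number t ≥ 0, writing N_t := N₀ + t and c(K) := 4/(K−5): U(K·N_t, N_t) ≤ c(K)·H(N_t) + (ξ/e^{K/5})·(3κ/(4·N_t))^{K/5}. -/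
/-- A fifth power estimate: `(1 - x/4)^5 ≤ 1 - x` on `[0, 1/4]`. -/
lemma one_sub_div_four_pow_five_le {x : ℝ} (hx0 : 0 ≤ x) (hx : x ≤ 1 / 4) :
    (1 - x / 4) ^ 5 ≤ 1 - x := by
  have h2 : 0 ≤ x * (1 / 4 - x) := mul_nonneg hx0 (by linarith)
  have h3 : 0 ≤ x ^ 3 * (1 / 4 - x) := mul_nonneg (by positivity) (by linarith)
  have h5 : 0 ≤ x ^ 5 := by positivity
  have h3' : 0 ≤ x ^ 3 := by positivity
  nlinarith

/-- Real-exponent form: `(1 - x/4)^K ≤ (1 - x)^(K/5)` on `[0, 1/4]`. -/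
lemma one_sub_div_four_pow_le_rpow {x : ℝ} (hx0 : 0 ≤ x) (hx : x ≤ 1 / 4) (K : ℕ) :
    (1 - x / 4) ^ K ≤ (1 - x) ^ ((K : ℝ) / 5) := by
  have hr : 0 ≤ 1 - x / 4 := by linarith
  calc (1 - x / 4) ^ K = ((1 - x / 4) ^ 5) ^ ((K : ℝ) / 5) := by
        rw [← Real.rpow_natCast (1 - x / 4) 5, ← Real.rpow_mul hr, ← Real.rpow_natCast]
        congr 1
        push_cast
        ring
    _ ≤ (1 - x) ^ ((K : ℝ) / 5) :=
        Real.rpow_le_rpow (by positivity) (one_sub_div_four_pow_five_le hx0 hx) (by positivity)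

/-- Bernoulli-type estimate absorbing the cost of one added sample into the contraction. -/
lemma one_sub_div_four_pow_mul_le {x : ℝ} (hx0 : 0 ≤ x) (hx : x ≤ 1 / 4) (j : ℕ) :
    (1 - x / 4) ^ (j + 5) * (1 + j * (x / 4)) ≤ 1 - x := by
  have hr : 0 ≤ 1 - x / 4 := by linarith
  have hb : 1 + j * (x / 4) ≤ (1 + x / 4) ^ j := one_add_mul_le_pow (by linarith) j
  have h1 : (1 - x / 4) ^ j * (1 + j * (x / 4)) ≤ 1 :=
    calc (1 - x / 4) ^ j * (1 + j * (x / 4)) ≤ (1 - x / 4) ^ j * (1 + x / 4) ^ j := by gcongr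
      _ = (1 - (x / 4) ^ 2) ^ j := by rw [← mul_pow]; ring
      _ ≤ 1 := pow_le_one₀ (by nlinarith) (by nlinarith)
  calc (1 - x / 4) ^ (j + 5) * (1 + j * (x / 4))
      = (1 - x / 4) ^ 5 * ((1 - x / 4) ^ j * (1 + j * (x / 4))) := by ring
    _ ≤ (1 - x / 4) ^ 5 * 1 := by gcongr
    _ ≤ 1 - x := by simpa using one_sub_div_four_pow_five_le hx0 hx

/-- For `β ≤ 1` the function `n ↦ n^(-β)` loses at most the factor `N / (N + 1)` in one
step. -/
lemma div_add_one_mul_rpow_neg_le {N β : ℝ} (hN : 0 < N) (hβ1 : β ≤ 1) :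
    N / (N + 1) * N ^ (-β) ≤ (N + 1) ^ (-β) := by
  have h1 : N / (N + 1) ≤ (N / (N + 1)) ^ β := by
    have hle : N / (N + 1) ≤ 1 := by rw [div_le_one (by positivity)]; linarith
    simpa using Real.rpow_le_rpow_of_exponent_ge (by positivity) hle hβ1
  calc N / (N + 1) * N ^ (-β) ≤ (N / (N + 1)) ^ β * N ^ (-β) := by gcongr
    _ = (N + 1) ^ (-β) := by
        rw [Real.div_rpow hN.le (by positivity), Real.rpow_neg hN.le,
          Real.rpow_neg (by positivity)]
        have := Real.rpow_pos_of_pos hN β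
        field_simp

/-- Deterministic core of Lemma 1. With `N₀ = 3κ/4 ≥ 3` a natural
number, `H(n) := d·n^(−β)`, `Γ_n := 1 − min(1/(4n), 1/(3κ))`, and the bound sequence `U`
defined recursively by `U 0 N₀ = ξ` and
`U k n = min (Γ_n·U (k−1) n) (min_{N₀ ≤ m < n} (U k m + ((n−m)/n)·H m))`
(a term being omitted from the outer minimum when undefined), one has, for every `K ≥ 6`
and every `t ≥ 0`, writing `N_t := N₀ + t` and `c(K) := 4/(K−5)`:
`U (K·N_t) N_t ≤ c(K)·H(N_t) + (ξ/e^(K/5))·(3κ/(4N_t))^(K/5)`. -/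
theorem online_saga_optimization_error_bound
    (κ d β ξ : ℝ) (N₀ : ℕ)
    (hκ : 0 < κ) (hd : 0 < d) (hβ0 : 0 < β) (hβ1 : β ≤ 1) (hξ : 0 ≤ ξ)
    (hN₀ : (N₀ : ℝ) = 3 * κ / 4) (hN₀3 : 3 ≤ N₀)
    (U : ℕ → ℕ → ℝ)
    (hU00 : U 0 N₀ = ξ)
    (hU0 : ∀ n : ℕ, ∀ hn : N₀ < n,
      U 0 n = (Finset.Ico N₀ n).inf' (Finset.nonempty_Ico.mpr hn)
        (fun m => U 0 m + (((n:ℝ) - m) / n) * (d * (m:ℝ) ^ (-β))))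
    (hUk : ∀ k : ℕ,
      U (k+1) N₀ = (1 - min (1 / (4 * (N₀:ℝ))) (1 / (3 * κ))) * U k N₀)
    (hUkn : ∀ k : ℕ, ∀ n : ℕ, ∀ hn : N₀ < n,
      U (k+1) n = min
        ((1 - min (1 / (4 * (n:ℝ))) (1 / (3 * κ))) * U k n)
        ((Finset.Ico N₀ n).inf' (Finset.nonempty_Ico.mpr hn)
          (fun m => U (k+1) m + (((n:ℝ) - m) / n) * (d * (m:ℝ) ^ (-β)))))
    (K : ℕ) (hK : 6 ≤ K) (t : ℕ) :
    U (K * (N₀ + t)) (N₀ + t)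
      ≤ (4 / ((K:ℝ) - 5)) * (d * ((N₀ + t : ℕ) : ℝ) ^ (-β))
        + (ξ / Real.exp ((K:ℝ) / 5)) * (3 * κ / (4 * ((N₀ + t : ℕ) : ℝ))) ^ ((K:ℝ) / 5) := by
  have hNpos : (0 : ℝ) < N₀ := by exact_mod_cast (by omega : 0 < N₀)
  have h3κ : 3 * κ = 4 * N₀ := by linarith
  have hΓ : ∀ n : ℕ, N₀ ≤ n →
      1 - min (1 / (4 * (n : ℝ))) (1 / (3 * κ)) = 1 - 1 / (4 * (n : ℝ)) := fun n hn => by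
    have hn' : (N₀ : ℝ) ≤ n := by exact_mod_cast hn
    rw [h3κ, min_eq_left (one_div_le_one_div_of_le (by positivity) (by linarith))]
  have hstep : ∀ n, N₀ ≤ n → ∀ k, U (k + 1) n ≤ (1 - 1 / (4 * (n : ℝ))) * U k n := by
    intro n hn k
    rw [← hΓ n hn]
    rcases hn.eq_or_lt with rfl | hlt
    · exact (hUk k).le
    · exact (hUkn k n hlt).le.trans (min_le_left _ _)
  have hpow : ∀ n, N₀ ≤ n → ∀ k j,
      U (k + j) n ≤ (1 - 1 / (4 * (n : ℝ))) ^ j * U k n := by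
    intro n hn k j
    have hn1 : (1 : ℝ) ≤ n := by exact_mod_cast (by omega : 1 ≤ n)
    have h0 : 0 ≤ 1 - 1 / (4 * (n : ℝ)) := by
      rw [sub_nonneg, div_le_one (by positivity)]
      linarith
    induction j with
    | zero => simp
    | succ j ih =>
      calc U (k + (j + 1)) n ≤ (1 - 1 / (4 * (n : ℝ))) * U (k + j) n := hstep n hn (k + j)
        _ ≤ (1 - 1 / (4 * (n : ℝ))) * ((1 - 1 / (4 * (n : ℝ))) ^ j * U k n) := by gcongr
        _ = (1 - 1 / (4 * (n : ℝ))) ^ (j + 1) * U k n := by ring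
  have hgrow : ∀ n, N₀ ≤ n → ∀ k,
      U k (n + 1) ≤ U k n + 1 / ((n : ℝ) + 1) * (d * (n : ℝ) ^ (-β)) := by
    intro n hn k
    have hlt : N₀ < n + 1 := by omega
    have hmem : n ∈ Finset.Ico N₀ (n + 1) := Finset.mem_Ico.mpr ⟨hn, by omega⟩
    have hc : (((n + 1 : ℕ) : ℝ) - n) / ((n + 1 : ℕ) : ℝ) = 1 / ((n : ℝ) + 1) := by
      push_cast
      ring
    rw [← hc]
    cases k with
    | zero =>
      rw [hU0 (n + 1) hlt]
      exact Finset.inf'_le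
        (fun m : ℕ => U 0 m + ((((n + 1 : ℕ) : ℝ) - m) / ((n + 1 : ℕ) : ℝ)) *
          (d * (m : ℝ) ^ (-β))) hmem
    | succ k =>
      rw [hUkn k (n + 1) hlt]
      exact (min_le_right _ _).trans (Finset.inf'_le
        (fun m : ℕ => U (k + 1) m + ((((n + 1 : ℕ) : ℝ) - m) / ((n + 1 : ℕ) : ℝ)) *
          (d * (m : ℝ) ^ (-β))) hmem)
  rw [h3κ]
  obtain ⟨j, rfl⟩ : ∃ j, K = j + 5 := ⟨K - 5, by omega⟩
  have hj : (0 : ℝ) < j := by exact_mod_cast (by omega : 0 < j)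
  have hcj : ((j + 5 : ℕ) : ℝ) - 5 = j := by push_cast; ring
  rw [hcj]
  set K := j + 5
  induction t with
  | zero =>
    have hb := hpow N₀ le_rfl 0 (K * N₀)
    rw [hU00, zero_add] at hb
    have hq : (1 - 1 / (4 * (N₀ : ℝ))) ^ (K * N₀) ≤ Real.exp (-((K : ℝ) / 5)) := by
      have hN1 : (1 : ℝ) ≤ N₀ := by exact_mod_cast (by omega : 1 ≤ N₀)
      have h0 : 0 ≤ 1 - 1 / (4 * (N₀ : ℝ)) := by
        rw [sub_nonneg, div_le_one (by positivity)]
        linarith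
      calc (1 - 1 / (4 * (N₀ : ℝ))) ^ (K * N₀)
          ≤ Real.exp (-(1 / (4 * (N₀ : ℝ)))) ^ (K * N₀) := by
            gcongr
            exact Real.one_sub_le_exp_neg _
        _ = Real.exp (-((K : ℝ) / 4)) := by
            rw [← Real.exp_nat_mul]
            congr 1
            push_cast
            field_simp
        _ ≤ Real.exp (-((K : ℝ) / 5)) := by
            apply Real.exp_le_exp.mpr
            have : (0 : ℝ) ≤ K := K.cast_nonneg
            linarith
    have h1 : U (K * N₀) N₀ ≤ ξ / Real.exp ((K : ℝ) / 5) := by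
      calc U (K * N₀) N₀ ≤ _ := hb
        _ ≤ Real.exp (-((K : ℝ) / 5)) * ξ := by gcongr
        _ = ξ / Real.exp ((K : ℝ) / 5) := by rw [Real.exp_neg]; ring
    have h2 : 0 ≤ 4 / (j : ℝ) * (d * (N₀ : ℝ) ^ (-β)) := by positivity
    simp only [add_zero]
    rw [div_self (by positivity), Real.one_rpow, mul_one]
    linarith
  | succ t ih =>
    rw [← add_assoc]
    set N := N₀ + t with hN
    have hNN : N₀ ≤ N := by omega
    have hN3 : (3 : ℝ) ≤ N := by exact_mod_cast (by omega : 3 ≤ N)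
    have hNp : (0 : ℝ) < N := by linarith
    set x : ℝ := 1 / ((N : ℝ) + 1) with hx
    have hx0 : 0 ≤ x := by positivity
    have hx4 : x ≤ 1 / 4 := one_div_le_one_div_of_le (by norm_num) (by linarith)
    have hx1 : 1 - x = N / ((N : ℝ) + 1) := by rw [hx]; field_simp; ring
    have hq0 : 0 ≤ (1 - x / 4) ^ K := pow_nonneg (by linarith) _
    have hrun := hpow (N + 1) (by omega) (K * N) K
    have hrx : 1 - 1 / (4 * ((N + 1 : ℕ) : ℝ)) = 1 - x / 4 := by
      rw [hx]; push_cast; field_simp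
    rw [hrx, ← Nat.mul_succ] at hrun
    set H : ℝ := d * (N : ℝ) ^ (-β) with hH
    have hH0 : 0 ≤ H := by positivity
    have hstat : (1 - x / 4) ^ K * (4 / (j : ℝ) * H + x * H)
        ≤ 4 / (j : ℝ) * (d * ((N : ℝ) + 1) ^ (-β)) := by
      calc (1 - x / 4) ^ K * (4 / (j : ℝ) * H + x * H)
          = 4 / (j : ℝ) * ((1 - x / 4) ^ K * (1 + j * (x / 4)) * H) := by field_simp
        _ ≤ 4 / (j : ℝ) * ((1 - x) * H) := by
            gcongr
            exact one_sub_div_four_pow_mul_le hx0 hx4 j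
        _ = 4 / (j : ℝ) * (d * (N / ((N : ℝ) + 1) * (N : ℝ) ^ (-β))) := by
            rw [hx1, hH]; ring
        _ ≤ 4 / (j : ℝ) * (d * ((N : ℝ) + 1) ^ (-β)) := by
            gcongr
            exact div_add_one_mul_rpow_neg_le hNp hβ1
    have hinit : (1 - x / 4) ^ K * (4 * (N₀ : ℝ) / (4 * (N : ℝ))) ^ ((K : ℝ) / 5)
        ≤ (4 * (N₀ : ℝ) / (4 * ((N : ℝ) + 1))) ^ ((K : ℝ) / 5) := by
      calc (1 - x / 4) ^ K * (4 * (N₀ : ℝ) / (4 * (N : ℝ))) ^ ((K : ℝ) / 5)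
          ≤ (1 - x) ^ ((K : ℝ) / 5) * (4 * (N₀ : ℝ) / (4 * (N : ℝ))) ^ ((K : ℝ) / 5) := by
            gcongr
            exact one_sub_div_four_pow_le_rpow hx0 hx4 K
        _ = (4 * (N₀ : ℝ) / (4 * ((N : ℝ) + 1))) ^ ((K : ℝ) / 5) := by
            rw [← Real.mul_rpow (by linarith) (by positivity), hx1]
            congr 1
            field_simp
    have hξ' : 0 ≤ ξ / Real.exp ((K : ℝ) / 5) := by positivity
    push_cast
    calc U (K * (N + 1)) (N + 1) ≤ (1 - x / 4) ^ K * U (K * N) (N + 1) := hrun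
      _ ≤ (1 - x / 4) ^ K * (U (K * N) N + x * H) :=
          mul_le_mul_of_nonneg_left (hgrow N hNN (K * N)) hq0
      _ ≤ (1 - x / 4) ^ K * (4 / (j : ℝ) * H + ξ / Real.exp ((K : ℝ) / 5) *
            (4 * (N₀ : ℝ) / (4 * (N : ℝ))) ^ ((K : ℝ) / 5) + x * H) :=
          mul_le_mul_of_nonneg_left (by linarith) hq0
      _ = (1 - x / 4) ^ K * (4 / (j : ℝ) * H + x * H) + ξ / Real.exp ((K : ℝ) / 5) *
            ((1 - x / 4) ^ K * (4 * (N₀ : ℝ) / (4 * (N : ℝ))) ^ ((K : ℝ) / 5)) := by ring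
      _ ≤ _ := add_le_add hstat (mul_le_mul_of_nonneg_left hinit hξ')
end

section
/- Fix reals κ > 0, d > 0, β ∈ (0, 1], ξ ≥ 0, and assume N₀ := 3κ/4 is a natural number with N₀ ≥ 3. Define H(n) := d·n^{−β} and Γ_n := 1 − min(1/(4n), 1/(3κ)). Define the bound sequence U(k, n), for natural numbers n ≥ N₀ and k ≥ 0, recursively by U(0, N₀) = ξ and U(k, n) = min( Γ_n·U(k−1, n), min_{N₀ ≤ m < n} [ U(k, m) + ((n−m)/n)·H(m) ] ), where a term is omitted from the outer minimum when it is undefined (the first term when k = 0, the inner minimum when n = N₀). Then for every natural number N of the form N = 8·(N₀ + t) with t ≥ 0: U(N, N) ≤ c(1)·d·N^{−β} + ξ·(6κ/(e·N))^{8/5}, where c(1) := (11/6)·8^β + 4^β/2 + 2^{β−1}. -/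
lemma one_sub_pow_five_le {x : ℝ} (hx0 : 0 ≤ x) (hx : x ≤ 1 / 16) :
    (1 - x) ^ 5 ≤ 1 - 4 * x := by
  have h2 : 0 ≤ x * (1 / 16 - x) := mul_nonneg hx0 (by linarith)
  have h3 : 0 ≤ x ^ 3 * (10 - 5 * x + x ^ 2) :=
    mul_nonneg (by positivity) (by nlinarith [sq_nonneg x])
  nlinarith

lemma one_sub_pow_three_mul_le (x : ℝ) :
    (1 - x) ^ 3 * (1 + 3 * x) ≤ 1 := by
  have h : 0 ≤ x ^ 2 * (6 - 8 * x + 3 * x ^ 2) :=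
    mul_nonneg (by positivity) (by nlinarith [sq_nonneg (3 * x - 4)])
  nlinarith

lemma one_sub_pow_eight_mul_le {x : ℝ} (hx0 : 0 ≤ x) (hx : x ≤ 1 / 16) :
    (1 - x) ^ 8 * (1 + 3 * x) ≤ 1 - 4 * x := by
  have h0 : 0 ≤ (1 - x) ^ 3 * (1 + 3 * x) :=
    mul_nonneg (pow_nonneg (by linarith) 3) (by linarith)
  calc (1 - x) ^ 8 * (1 + 3 * x) = (1 - x) ^ 5 * ((1 - x) ^ 3 * (1 + 3 * x)) := by ring
    _ ≤ (1 - 4 * x) * 1 :=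
      mul_le_mul (one_sub_pow_five_le hx0 hx) (one_sub_pow_three_mul_le x) h0
        (by linarith)
    _ = 1 - 4 * x := mul_one _

lemma one_sub_pow_eight_le_rpow {x : ℝ} (hx0 : 0 ≤ x) (hx : x ≤ 1 / 16) :
    (1 - x) ^ 8 ≤ (1 - 4 * x) ^ ((8 : ℝ) / 5) := by
  have h1 : 0 ≤ 1 - x := by linarith
  calc (1 - x) ^ 8 = ((1 - x) ^ 5) ^ ((8 : ℝ) / 5) := by
        rw [← Real.rpow_natCast (1 - x) 5, ← Real.rpow_mul h1, ← Real.rpow_natCast (1 - x) 8]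
        norm_num
    _ ≤ _ := Real.rpow_le_rpow (pow_nonneg h1 5) (one_sub_pow_five_le hx0 hx) (by norm_num)

lemma one_sub_pow_eight_mul_le_exp {n : ℕ} (hn : 1 ≤ n) :
    (1 - 1 / (4 * (n : ℝ))) ^ (8 * n) ≤ (1 / Real.exp 1) ^ ((8 : ℝ) / 5) := by
  have hn' : (1 : ℝ) ≤ n := by exact_mod_cast hn
  have h0 : 0 ≤ 1 - 1 / (4 * (n : ℝ)) := by
    rw [sub_nonneg, div_le_one (by positivity)]; linarith
  calc (1 - 1 / (4 * (n : ℝ))) ^ (8 * n) ≤ Real.exp (-(1 / (4 * (n : ℝ)))) ^ (8 * n) :=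
        pow_le_pow_left₀ h0 (Real.one_sub_le_exp_neg _) _
    _ = Real.exp (-2) := by
        rw [← Real.exp_nat_mul]; congr 1; push_cast; field_simp; norm_num
    _ ≤ Real.exp (-(8 / 5)) := Real.exp_le_exp.mpr (by norm_num)
    _ = (1 / Real.exp 1) ^ ((8 : ℝ) / 5) := by
        rw [one_div, ← Real.exp_neg, ← Real.exp_mul]; norm_num

/-- A sequence that contracts by `1 - 1 / (4 n)` per iteration on `n` samples and pays
`d * n ^ (-β) / (n + 1)` for adding one sample is of order `d * n ^ (-β)` after eight iterations
per sample. -/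
lemma eight_iterations_bound {d β ξ : ℝ} {N₀ : ℕ} {U : ℕ → ℕ → ℝ}
    (hd : 0 < d) (hβ1 : β ≤ 1) (hξ : 0 ≤ ξ) (hN₀3 : 3 ≤ N₀) (hU00 : U 0 N₀ = ξ)
    (hcontr : ∀ j k n : ℕ, N₀ ≤ n → U (k + j) n ≤ (1 - 1 / (4 * (n : ℝ))) ^ j * U k n)
    (hgrow : ∀ k m n : ℕ, N₀ ≤ m → m < n →
      U k n ≤ U k m + (((n : ℝ) - m) / n) * (d * (m : ℝ) ^ (-β))) (t : ℕ) :
    U (8 * (N₀ + t)) (N₀ + t) ≤ 4 / 3 * (d * ((N₀ + t : ℕ) : ℝ) ^ (-β))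
      + ξ * ((N₀ : ℝ) / (Real.exp 1 * ((N₀ + t : ℕ) : ℝ))) ^ ((8 : ℝ) / 5) := by
  induction t with
  | zero =>
    have h := hcontr (8 * N₀) 0 N₀ le_rfl
    have hN₀ : (N₀ : ℝ) ≠ 0 := by positivity
    have hdiv : (N₀ : ℝ) / (Real.exp 1 * N₀) = 1 / Real.exp 1 := by field_simp
    rw [zero_add, hU00] at h
    have h2 := mul_le_mul_of_nonneg_right
      (one_sub_pow_eight_mul_le_exp (n := N₀) (by omega)) hξ
    have h3 : 0 ≤ 4 / 3 * (d * (N₀ : ℝ) ^ (-β)) := by positivity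
    rw [add_zero, hdiv]
    linarith
  | succ t ih =>
    rw [← add_assoc]
    generalize hn : N₀ + t = n at ih ⊢
    have hn3 : (3 : ℝ) ≤ n := by exact_mod_cast (by omega : 3 ≤ n)
    have hc := hcontr 8 (8 * n) (n + 1) (by omega)
    have hg := hgrow (8 * n) n (n + 1) (by omega) (by omega)
    rw [show 8 * n + 8 = 8 * (n + 1) by ring] at hc
    push_cast at hc hg ⊢
    have hx0 : 0 ≤ 1 / (4 * ((n : ℝ) + 1)) := by positivity
    have hx1 : 1 / (4 * ((n : ℝ) + 1)) ≤ 1 / 16 :=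
      one_div_le_one_div_of_le (by norm_num) (by linarith)
    have hx4 : 1 - 4 * (1 / (4 * ((n : ℝ) + 1))) = n / (n + 1) := by field_simp; ring
    have hfrac : ((n : ℝ) + 1 - n) / (n + 1) = 4 * (1 / (4 * ((n : ℝ) + 1))) := by
      field_simp; ring
    have hH := one_sub_pow_eight_mul_le hx0 hx1
    have hR := one_sub_pow_eight_le_rpow hx0 hx1
    have hp0 : 0 ≤ (1 - 1 / (4 * ((n : ℝ) + 1))) ^ 8 := by positivity
    rw [hx4] at hH hR
    rw [hfrac] at hg
    have hHn : ((n : ℝ) / (n + 1)) * (n : ℝ) ^ (-β) ≤ ((n : ℝ) + 1) ^ (-β) := by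
      have hq : (n : ℝ) / (n + 1) ≤ ((n : ℝ) / (n + 1)) ^ β :=
        Real.self_le_rpow_of_le_one (by positivity)
          ((div_le_one (by positivity)).mpr (by linarith)) hβ1
      calc ((n : ℝ) / (n + 1)) * (n : ℝ) ^ (-β)
          ≤ ((n : ℝ) / (n + 1)) ^ β * (n : ℝ) ^ (-β) := by gcongr
        _ = ((n : ℝ) + 1) ^ (-β) := by
          rw [Real.div_rpow (by positivity) (by positivity), Real.rpow_neg (by positivity),
            Real.rpow_neg (by positivity)]
          have := (Real.rpow_pos_of_pos (by linarith : (0 : ℝ) < n) β).ne'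
          field_simp
    have hRn : ((n : ℝ) / (n + 1)) ^ ((8 : ℝ) / 5)
        * ((N₀ : ℝ) / (Real.exp 1 * n)) ^ ((8 : ℝ) / 5)
        = ((N₀ : ℝ) / (Real.exp 1 * (n + 1))) ^ ((8 : ℝ) / 5) := by
      rw [← Real.mul_rpow (by positivity) (by positivity)]
      congr 1
      field_simp
    rw [← hRn]
    generalize 1 / (4 * ((n : ℝ) + 1)) = x at *
    have hr : 0 ≤ ((N₀ : ℝ) / (Real.exp 1 * n)) ^ ((8 : ℝ) / 5) := by positivity
    generalize ((N₀ : ℝ) / (Real.exp 1 * n)) ^ ((8 : ℝ) / 5) = r at *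
    calc U (8 * (n + 1)) (n + 1) ≤ (1 - x) ^ 8 * U (8 * n) (n + 1) := hc
      _ ≤ (1 - x) ^ 8 * ((4 / 3 * (d * (n : ℝ) ^ (-β)) + ξ * r)
            + 4 * x * (d * (n : ℝ) ^ (-β))) :=
          mul_le_mul_of_nonneg_left (by linarith) hp0
      _ = 4 / 3 * (d * (((1 - x) ^ 8 * (1 + 3 * x)) * (n : ℝ) ^ (-β)))
            + ξ * ((1 - x) ^ 8 * r) := by ring
      _ ≤ 4 / 3 * (d * (((n : ℝ) / (n + 1)) * (n : ℝ) ^ (-β)))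
            + ξ * (((n : ℝ) / (n + 1)) ^ ((8 : ℝ) / 5) * r) := by gcongr
      _ ≤ _ := by gcongr

/-- Deterministic core of Proposition 2. With the bound sequence `U`
of Lemma 1 (recursively defined from `N₀ = 3κ/4 ≥ 3`, `ξ`, `H(n) := d·n^(−β)` and
`Γ_n := 1 − min(1/(4n), 1/(3κ))`), for every `N` of the form `N = 8·(N₀ + t)`:
`U N N ≤ c(1)·d·N^(−β) + ξ·(6κ/(e·N))^(8/5)` with
`c(1) := (11/6)·8^β + 4^β/2 + 2^(β−1)`. -/
theorem online_saga_one_pass_error_bound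
    (κ d β ξ : ℝ) (N₀ : ℕ)
    (hκ : 0 < κ) (hd : 0 < d) (hβ0 : 0 < β) (hβ1 : β ≤ 1) (hξ : 0 ≤ ξ)
    (hN₀ : (N₀ : ℝ) = 3 * κ / 4) (hN₀3 : 3 ≤ N₀)
    (U : ℕ → ℕ → ℝ)
    (hU00 : U 0 N₀ = ξ)
    (hU0 : ∀ n : ℕ, ∀ hn : N₀ < n,
      U 0 n = (Finset.Ico N₀ n).inf' (Finset.nonempty_Ico.mpr hn)
        (fun m => U 0 m + (((n:ℝ) - m) / n) * (d * (m:ℝ) ^ (-β))))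
    (hUk : ∀ k : ℕ,
      U (k+1) N₀ = (1 - min (1 / (4 * (N₀:ℝ))) (1 / (3 * κ))) * U k N₀)
    (hUkn : ∀ k : ℕ, ∀ n : ℕ, ∀ hn : N₀ < n,
      U (k+1) n = min
        ((1 - min (1 / (4 * (n:ℝ))) (1 / (3 * κ))) * U k n)
        ((Finset.Ico N₀ n).inf' (Finset.nonempty_Ico.mpr hn)
          (fun m => U (k+1) m + (((n:ℝ) - m) / n) * (d * (m:ℝ) ^ (-β)))))
    (t : ℕ) (N : ℕ) (hN : N = 8 * (N₀ + t)) :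
    U N N ≤ ((11/6 : ℝ) * (8:ℝ) ^ β + (4:ℝ) ^ β / 2 + (2:ℝ) ^ (β - 1)) * (d * (N:ℝ) ^ (-β))
        + ξ * (6 * κ / (Real.exp 1 * (N:ℝ))) ^ ((8:ℝ) / 5) := by
  have hgrow : ∀ k m n : ℕ, N₀ ≤ m → m < n →
      U k n ≤ U k m + (((n : ℝ) - m) / n) * (d * (m : ℝ) ^ (-β)) := by
    intro k m n hm hmn
    have hn : N₀ < n := hm.trans_lt hmn
    cases k with
    | zero =>
      rw [hU0 n hn]
      exact Finset.inf'_le _ (Finset.mem_Ico.mpr ⟨hm, hmn⟩)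
    | succ k =>
      rw [hUkn k n hn]
      exact (min_le_right _ _).trans (Finset.inf'_le _ (Finset.mem_Ico.mpr ⟨hm, hmn⟩))
  have hmin : ∀ n : ℕ, N₀ ≤ n → min (1 / (4 * (n : ℝ))) (1 / (3 * κ)) = 1 / (4 * (n : ℝ)) := by
    intro n hn
    have hn' : (N₀ : ℝ) ≤ n := by exact_mod_cast hn
    exact min_eq_left (one_div_le_one_div_of_le (by positivity) (by linarith))
  have hstep : ∀ k n : ℕ, N₀ ≤ n → U (k + 1) n ≤ (1 - 1 / (4 * (n : ℝ))) * U k n := by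
    intro k n hn
    rcases hn.eq_or_lt with rfl | hlt
    · rw [hUk k, hmin _ le_rfl]
    · rw [hUkn k n hlt, hmin n hn]
      exact min_le_left _ _
  have hcontr : ∀ j k n : ℕ, N₀ ≤ n →
      U (k + j) n ≤ (1 - 1 / (4 * (n : ℝ))) ^ j * U k n := by
    intro j k n hn
    have hn1 : (1 : ℝ) ≤ n := by exact_mod_cast (by omega : 1 ≤ n)
    have h0 : 0 ≤ 1 - 1 / (4 * (n : ℝ)) := by
      rw [sub_nonneg, div_le_one (by positivity)]; linarith
    induction j with
    | zero => simp
    | succ j ih =>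
      rw [← add_assoc, pow_succ', mul_assoc]
      exact (hstep _ n hn).trans (mul_le_mul_of_nonneg_left ih h0)
  have hdouble : ∀ k m : ℕ, N₀ ≤ m →
      U k (2 * m) ≤ U k m + 1 / 2 * (d * (m : ℝ) ^ (-β)) := by
    intro k m hm
    have h := hgrow k m (2 * m) hm (by omega)
    have hm0 : (m : ℝ) ≠ 0 := by exact_mod_cast (by omega : m ≠ 0)
    have hhalf : (((2 * m : ℕ) : ℝ) - m) / ((2 * m : ℕ) : ℝ) = 1 / 2 := by
      push_cast; field_simp; norm_num
    rwa [hhalf] at h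
  have hmain := eight_iterations_bound hd hβ1 hξ hN₀3 hU00 hcontr hgrow t
  obtain ⟨M, hM⟩ : ∃ M, M = N₀ + t := ⟨_, rfl⟩
  rw [← hM] at hmain hN
  have hM0 : (0 : ℝ) < M := by exact_mod_cast (by omega : 0 < M)
  have h1 := hdouble (8 * M) M (by omega)
  have h2 := hdouble (8 * M) (2 * M) (by omega)
  have h3 := hdouble (8 * M) (2 * (2 * M)) (by omega)
  rw [show 2 * (2 * (2 * M)) = N by omega] at h3
  rw [← hN] at hmain h1 h2 h3
  have hNM : (N : ℝ) = 8 * M := by rw [hN]; push_cast; ring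
  have hscale : ∀ c x : ℝ, 0 < c → 0 < x → x ^ (-β) = c ^ β * (c * x) ^ (-β) := by
    intro c x hc hx
    rw [Real.mul_rpow hc.le hx.le, ← mul_assoc, ← Real.rpow_add hc]
    simp
  have e1 : (M : ℝ) ^ (-β) = 8 ^ β * (N : ℝ) ^ (-β) := by
    rw [hscale 8 M (by norm_num) hM0, hNM]
  have e2 : ((2 * M : ℕ) : ℝ) ^ (-β) = 4 ^ β * (N : ℝ) ^ (-β) := by
    rw [hscale 4 _ (by norm_num) (by push_cast; positivity), hNM]
    push_cast; ring_nf
  have e3 : ((2 * (2 * M) : ℕ) : ℝ) ^ (-β) = 2 ^ β * (N : ℝ) ^ (-β) := by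
    rw [hscale 2 _ (by norm_num) (by push_cast; positivity), hNM]
    push_cast; ring_nf
  have e4 : (2 : ℝ) ^ (β - 1) = 2 ^ β / 2 := by
    rw [Real.rpow_sub (by norm_num), Real.rpow_one]
  have e5 : 6 * κ / (Real.exp 1 * (N : ℝ)) = N₀ / (Real.exp 1 * M) := by
    rw [hNM, hN₀]; field_simp; norm_num
  rw [e1] at hmain h1
  rw [e2] at h2
  rw [e3] at h3
  rw [e4, e5]
  linarith
end
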